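/- Let p be an imitation kernel with gcd(A) = 1 whose G-stochastic function P_(·) is irreducible and aperiodic. Then 𝒢(p) has exactly one element μ, and the single-site marginals of μ equal the unique invariant probability vector λ̂ of P̂ = Σ_{k∈A} θ_k P_(k): for all n ∈ ℤ and g ∈ G, μ({x : x_n = g}) = λ̂(g). -/

import Mathlib

open MeasureTheory
open scoped BigOperators

/-- The matrix of a word `𝐚 = (a_1, …, a_n)` (encoded as a list `[a_1, …, a_n]`),
namely `P_𝐚 = P_(a_n) ⋯ P_(a_1)`, so that `wordK P l i j` is the `(i,j)` entry. -/
noncomputable def wordK {G : Type*} [Fintype G] [DecidableEq G]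
    (P : ℕ → G → G → ℝ) : List ℕ → G → G → ℝ
  | [] => fun i j => if i = j then 1 else 0
  | a :: l => fun i j => ∑ m, wordK P l i m * P a m j

/-- A word over the alphabet `A`: a nonempty finite tuple with entries in `A`. -/
def IsWord (A : Set ℕ) (l : List ℕ) : Prop := l ≠ [] ∧ ∀ a ∈ l, a ∈ A

/-- `i` communicates with `j` if `P_𝐚(i,j) > 0` for some word `𝐚`. -/
def Communicates {G : Type*} [Fintype G] [DecidableEq G]
    (A : Set ℕ) (P : ℕ → G → G → ℝ) (i j : G) : Prop :=
  ∃ l : List ℕ, IsWord A l ∧ 0 < wordK P l i j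

/-- `i` and `j` intercommunicate (every state intercommunicates with itself). -/
def Intercommunicates {G : Type*} [Fintype G] [DecidableEq G]
    (A : Set ℕ) (P : ℕ → G → G → ℝ) (i j : G) : Prop :=
  i = j ∨ (Communicates A P i j ∧ Communicates A P j i)

/-- An intercommunicating class: an equivalence class of the intercommunication relation. -/
def IsInterClass {G : Type*} [Fintype G] [DecidableEq G]
    (A : Set ℕ) (P : ℕ → G → G → ℝ) (C : Set G) : Prop :=
  ∃ i : G, C = {j | Intercommunicates A P i j}

/-- A set `C` is closed if whenever `i ∈ C` communicates with `j`, then `j ∈ C`. -/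
def IsClosedClass {G : Type*} [Fintype G] [DecidableEq G]
    (A : Set ℕ) (P : ℕ → G → G → ℝ) (C : Set G) : Prop :=
  ∀ i ∈ C, ∀ j : G, Communicates A P i j → j ∈ C

/-- `d` is the greatest common divisor of the set `S ⊆ ℕ`. -/
def IsGCDOfSet (S : Set ℕ) (d : ℕ) : Prop :=
  (∀ n ∈ S, d ∣ n) ∧ ∀ e : ℕ, (∀ n ∈ S, e ∣ n) → e ∣ d

/-- The set of depths `s(𝐚)` of words `𝐚` with `P_𝐚(i,i) > 0`. -/
def ReturnDepths {G : Type*} [Fintype G] [DecidableEq G]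
    (A : Set ℕ) (P : ℕ → G → G → ℝ) (i : G) : Set ℕ :=
  {s | ∃ l : List ℕ, IsWord A l ∧ 0 < wordK P l i i ∧ l.sum = s}

/-- `E` is measurable with respect to the coordinates `(x_m)_{m < n}`. -/
def PastMeasurable {G : Type*} [MeasurableSpace G] (n : ℤ) (E : Set (ℤ → G)) : Prop :=
  MeasurableSet[MeasurableSpace.comap
    (fun x : ℤ → G => fun m : {m : ℤ // m < n} => x m.1) MeasurableSpace.pi] E

/-- `μ` is compatible with the imitation kernel
`p(g | w_{-1}, w_{-2}, …) = ∑_{k ∈ A} θ_k P_(k)(w_{-k}, g)` (here `θ` vanishes off `A`). -/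
def Compatible {G : Type*} [MeasurableSpace G] (θ : ℕ → ℝ) (P : ℕ → G → G → ℝ)
    (μ : Measure (ℤ → G)) : Prop :=
  ∀ (n : ℤ) (g : G) (E : Set (ℤ → G)), PastMeasurable n E →
    (μ (E ∩ {x | x n = g})).toReal
      = ∫ x in E, (∑' k : ℕ, θ k * P k (x (n - (k : ℤ))) g) ∂μ

/-- `BackReach S d g j`: a chain of backward steps of total depth `d` leads from `g` to `j`,
where `S k g i` means that a single step of depth `k` from `g` to `i` is allowed. -/
inductive BackReach {G : Type*} (S : ℕ → G → G → Prop) : ℕ → G → G → Prop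
  | refl (g : G) : BackReach S 0 g g
  | step {k d : ℕ} {g i j : G} : S k g i → BackReach S d i j → BackReach S (k + d) g j

namespace BackReach

variable {G : Type*} {S : ℕ → G → G → Prop}

theorem trans {d e : ℕ} {g i j : G} (h : BackReach S d g i) (h' : BackReach S e i j) :
    BackReach S (d + e) g j := by
  induction h with
  | refl => simpa using h'
  | step hs _ ih => rw [add_assoc]; exact .step hs (ih h')

theorem exists_step {d : ℕ} {g j : G} (h : BackReach S d g j) (hd : 0 < d) :
    ∃ k e i, d = k + e ∧ S k g i ∧ BackReach S e i j := by
  cases h with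
  | refl => exact absurd hd (lt_irrefl 0)
  | step hs h => exact ⟨_, _, _, rfl, hs, h⟩

/-- In an irreducible system in which the return depths of each state have greatest common
divisor one, every state is reached from every other one at all large depths. -/
theorem eventually [Finite G] (hirr : ∀ g j, ∃ d, BackReach S d g j)
    (haper : ∀ g, ∀ e : ℕ, (∀ d, BackReach S d g g → e ∣ d) → e ∣ 1) :
    ∃ n₀, ∀ d ≥ n₀, ∀ g j, BackReach S d g j := by
  classical
  have key : ∀ p : G × G, ∃ n₀, ∀ d ≥ n₀, BackReach S d p.1 p.2 := by
    rintro ⟨g, j⟩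
    let T : AddSubmonoid ℕ :=
      { carrier := {d | BackReach S d g g}
        zero_mem' := .refl g
        add_mem' := fun h h' => h.trans h' }
    obtain ⟨n, hn⟩ := Nat.exists_mem_closure_of_ge (T : Set ℕ)
    obtain ⟨d₀, hd₀⟩ := hirr g j
    refine ⟨n + d₀, fun d hd => ?_⟩
    have h1 : Nat.setGcd (T : Set ℕ) = 1 :=
      Nat.dvd_one.mp (haper g _ fun d hd => Nat.setGcd_dvd_of_mem hd)
    have h2 := hn (d - d₀) (by omega) (by rw [h1]; exact one_dvd _)
    rw [AddSubmonoid.closure_eq] at h2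
    have h3 : BackReach S (d - d₀) g g := h2
    have h4 := h3.trans hd₀
    rwa [Nat.sub_add_cancel (by omega)] at h4
  choose f hf using key
  obtain ⟨B, hB⟩ := (Set.finite_range f).bddAbove
  exact ⟨B, fun d hd g j => hf (g, j) d ((hB ⟨(g, j), rfl⟩).trans hd)⟩

end BackReach

section Walkers

variable {ι G : Type*} [DecidableEq ι] {S : ℕ → G → G → Prop}
  {V : (ι → ℤ × G) → ℝ} {M q : ℝ} {K : ℕ}

/-- If the top walker of `c` is far above the others, its position can be lowered. -/
theorem pow_mul_le_of_backReach (hq : 0 < q) (hq1 : q ≤ 1) (hV : ∀ c, 0 ≤ V c)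
    (hSpos : ∀ k g i, S k g i → 0 < k)
    (hstep : ∀ c a, (∀ b ≠ a, (c b).1 < (c a).1) → ∀ k ≤ K, ∀ i, S k (c a).2 i →
      q * V (Function.update c a ((c a).1 - k, i)) ≤ V c)
    {d : ℕ} {g j : G} (h : BackReach S d g j) (hd : d ≤ K) (c : ι → ℤ × G) (a : ι)
    (hg : (c a).2 = g) (hc : ∀ b ≠ a, (c b).1 < (c a).1 - d) :
    q ^ d * V (Function.update c a ((c a).1 - d, j)) ≤ V c := by
  induction h generalizing c with
  | refl g =>
    have : Function.update c a ((c a).1 - (0 : ℕ), g) = c := by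
      rw [← hg]; simp
    rw [this]; simp
  | @step k d g i j hs _ ih =>
    have hk := hSpos _ _ _ hs
    have h1 := hstep c a (fun b hb => by have := hc b hb; push_cast at this; omega) k (by omega) i
      (hg ▸ hs)
    set c' := Function.update c a ((c a).1 - (k : ℤ), i) with hc'
    have hc'a : c' a = ((c a).1 - (k : ℤ), i) := by simp [hc']
    have h2 := ih (by omega) c' (by rw [hc'a]) (fun b hb => by
      have := hc b hb
      rw [hc'a, hc', Function.update_of_ne hb]
      push_cast at this
      simp only
      omega)
    have h3 : Function.update c' a ((c' a).1 - (d : ℤ), j)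
        = Function.update c a ((c a).1 - ((k + d : ℕ) : ℤ), j) := by
      rw [hc'a, hc', Function.update_idem]
      congr 2
      push_cast
      ring
    rw [h3] at h2
    set v := V (Function.update c a ((c a).1 - ((k + d : ℕ) : ℤ), j)) with hv
    have hv0 : 0 ≤ v := hV _
    calc q ^ (k + d) * v ≤ q ^ (1 + d) * v := by
          gcongr ?_ * v
          exact pow_le_pow_of_le_one hq.le hq1 (by omega)
      _ = q * (q ^ d * v) := by ring
      _ ≤ q * V c' := by gcongr
      _ ≤ V c := h1

/-- Two walkers that can both reach the site `L` are forced to meet. -/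
theorem pow_mul_le_of_meet [Fintype ι] (hq : 0 < q) (hq1 : q ≤ 1) (hM : 0 ≤ M)
    (hSpos : ∀ k g i, S k g i → 0 < k)
    (hpred : ∀ g, ∃ k ≤ K, ∃ i, S k g i)
    (hstep : ∀ c a, (∀ b ≠ a, (c b).1 < (c a).1) → ∀ k ≤ K, ∀ i, S k (c a).2 i →
      q * V (Function.update c a ((c a).1 - k, i)) ≤ V c)
    (hcoin : ∀ c a b, a ≠ b → (c a).1 = (c b).1 → V c = M) (L : ℤ) {a b : ι} (hab : a ≠ b)
    (m : ℕ) (c : ι → ℤ × G) (hm : ∑ e, ((c e).1 - L).toNat = m)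
    (hR : ∀ e, e = a ∨ e = b → ∃ d ≤ K, ∃ j, (c e).1 - d = L ∧ BackReach S d (c e).2 j) :
    q ^ m * M ≤ V c := by
  induction m using Nat.strong_induction_on generalizing c with
  | _ m ih =>
  by_cases hinj : ∃ e f, e ≠ f ∧ (c e).1 = (c f).1
  · obtain ⟨e, f, hef, h⟩ := hinj
    rw [hcoin c e f hef h]
    exact mul_le_of_le_one_left hM (pow_le_one₀ hq.le hq1)
  push Not at hinj
  have : Nonempty ι := ⟨a⟩
  obtain ⟨t, ht⟩ := Finite.exists_max fun e => (c e).1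
  have htop : ∀ e ≠ t, (c e).1 < (c t).1 := fun e he => lt_of_le_of_ne (ht e) (hinj e t he)
  have hL : ∀ e, e = a ∨ e = b → L ≤ (c e).1 := fun e he => by
    obtain ⟨d, -, j, h, -⟩ := hR e he
    omega
  have htL : L < (c t).1 := by
    by_cases h : a = t
    · have := htop b (h ▸ hab.symm)
      have := hL b (.inr rfl)
      omega
    · have := htop a h
      have := hL a (.inl rfl)
      omega
  obtain ⟨k, hkK, i, hs, hR'⟩ : ∃ k ≤ K, ∃ i, S k (c t).2 i ∧
      (t = a ∨ t = b → ∃ d ≤ K, ∃ j, (c t).1 - k - d = L ∧ BackReach S d i j) := by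
    by_cases h : t = a ∨ t = b
    · obtain ⟨d, hd, j, hdL, hr⟩ := hR t h
      obtain ⟨k, e, i, rfl, hs, hr'⟩ := hr.exists_step (by omega)
      exact ⟨k, by omega, i, hs, fun _ => ⟨e, by omega, j, by push_cast at hdL; omega, hr'⟩⟩
    · obtain ⟨k, hk, i, hs⟩ := hpred (c t).2
      exact ⟨k, hk, i, hs, fun h' => absurd h' h⟩
  have hk := hSpos _ _ _ hs
  have h1 := hstep c t htop k hkK i hs
  set c' := Function.update c t ((c t).1 - (k : ℤ), i) with hc'
  have hc't : c' t = ((c t).1 - (k : ℤ), i) := by simp [hc']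
  have hc'e : ∀ e ≠ t, c' e = c e := fun e he => by simp [hc', he]
  have hlt : ∑ e, ((c' e).1 - L).toNat < m := by
    rw [← hm]
    refine Finset.sum_lt_sum (fun e _ => ?_) ⟨t, Finset.mem_univ t, ?_⟩
    · by_cases he : e = t
      · subst he; rw [hc't]; simp only; omega
      · rw [hc'e e he]
    · rw [hc't]; simp only; omega
  have h2 := ih _ hlt c' rfl (fun e he => by
    by_cases het : e = t
    · subst het; rw [hc't]; exact hR' he
    · rw [hc'e e het]; exact hR e he)
  calc q ^ m * M ≤ q ^ (1 + ∑ e, ((c' e).1 - L).toNat) * M := by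
        gcongr ?_ * M
        exact pow_le_pow_of_le_one hq.le hq1 (by omega)
    _ = q * (q ^ (∑ e, ((c' e).1 - L).toNat) * M) := by ring
    _ ≤ q * V c' := by gcongr
    _ ≤ V c := h1

/-- A uniform lower bound for superharmonic functions of finitely many walkers. -/
theorem exists_pos_mul_le [Fintype ι] [Nonempty ι] [Fintype G] {n₀ : ℕ}
    (hq : 0 < q) (hq1 : q ≤ 1) (hM : 0 ≤ M)
    (hV : ∀ c, 0 ≤ V c) (hSpos : ∀ k g i, S k g i → 0 < k)
    (hpred : ∀ g, ∃ k ≤ K, ∃ i, S k g i) (hK : 2 * n₀ ≤ K)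
    (hreach : ∀ d ≥ n₀, ∀ g j, BackReach S d g j)
    (hstep : ∀ c a, (∀ b ≠ a, (c b).1 < (c a).1) → ∀ k ≤ K, ∀ i, S k (c a).2 i →
      q * V (Function.update c a ((c a).1 - k, i)) ≤ V c)
    (hcoin : ∀ c a b, a ≠ b → (c a).1 = (c b).1 → V c = M)
    {lam : G → ℝ} (hlam : ∀ g, 0 ≤ lam g) (hlam1 : ∑ g, lam g = 1)
    (hmarg : ∀ c a n, ∑ g, lam g * V (Function.update c a (n, g)) = M) :
    ∃ δ > 0, ∀ c, δ * M ≤ V c := by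
  refine ⟨q ^ (Fintype.card ι * (2 * n₀) + n₀), by positivity, fun c => ?_⟩
  obtain ⟨a, ha⟩ := Finite.exists_max fun e => (c e).1
  by_cases hgap : ∀ b ≠ a, (c b).1 < (c a).1 - n₀
  · have h1 : ∀ g, q ^ n₀ * V (Function.update c a ((c a).1 - (n₀ : ℤ), g)) ≤ V c := fun g =>
      pow_mul_le_of_backReach hq hq1 hV hSpos hstep (hreach n₀ le_rfl (c a).2 g) (by omega) c a rfl
        hgap
    calc q ^ (Fintype.card ι * (2 * n₀) + n₀) * M ≤ q ^ n₀ * M := by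
          gcongr ?_ * M
          exact pow_le_pow_of_le_one hq.le hq1 (by omega)
      _ = ∑ g, lam g * (q ^ n₀ * V (Function.update c a ((c a).1 - (n₀ : ℤ), g))) := by
          rw [← hmarg c a ((c a).1 - (n₀ : ℤ)), Finset.mul_sum]
          exact Finset.sum_congr rfl fun g _ => by ring
      _ ≤ ∑ g, lam g * V c := by
          gcongr with g _
          · exact hlam g
          · exact h1 g
      _ = V c := by rw [← Finset.sum_mul, hlam1, one_mul]
  · push Not at hgap
    obtain ⟨b, hb, hba⟩ := hgap
    set L : ℤ := (c b).1 - n₀ with hL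
    have hab : (c b).1 ≤ (c a).1 := ha b
    have hmeet := pow_mul_le_of_meet hq hq1 hM hSpos hpred hstep hcoin L hb.symm _ c rfl
      (fun e he => by
        rcases he with rfl | rfl
        · exact ⟨((c e).1 - L).toNat, by omega, (c e).2, by omega, hreach _ (by omega) _ _⟩
        · exact ⟨n₀, by omega, (c e).2, by omega, hreach _ le_rfl _ _⟩)
    refine le_trans ?_ hmeet
    gcongr ?_ * M
    refine pow_le_pow_of_le_one hq.le hq1 ?_
    have : ∑ e, ((c e).1 - L).toNat ≤ ∑ _e : ι, 2 * n₀ :=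
      Finset.sum_le_sum fun e _ => by
        have : (c e).1 ≤ (c a).1 := ha e
        omega
    simp only [Finset.sum_const, Finset.card_univ, smul_eq_mul] at this
    omega

end Walkers

section Harmonic

variable {ι G : Type*} [DecidableEq ι] [Fintype ι] [Nonempty ι] [Fintype G]
  {A : Set ℕ} {θ : ℕ → ℝ} {P : ℕ → G → G → ℝ} {lam : G → ℝ}

/-- A bounded function of finitely many walkers that is harmonic for the motion of the top walker,
vanishes on coincidences and has vanishing marginals, is nonpositive. -/
theorem nonpos_of_harmonic (hApos : ∀ k ∈ A, 0 < k) (hθpos : ∀ k ∈ A, 0 < θ k)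
    (hθ0 : ∀ k, k ∉ A → θ k = 0) (hPnn : ∀ k ∈ A, ∀ i j : G, 0 ≤ P k i j)
    {n₀ : ℕ} (hreach : ∀ d ≥ n₀, ∀ g j, BackReach (fun k g i => k ∈ A ∧ 0 < P k i g) d g j)
    (hlam : ∀ g, 0 < lam g) (hlam1 : ∑ g, lam g = 1)
    (hinv : ∀ g, HasSum (fun k => θ k * ∑ i, lam i * P k i g) (lam g))
    {D : (ι → ℤ × G) → ℝ} {B : ℝ} (hB : ∀ c, |D c| ≤ B)
    (hharm : ∀ c a, (∀ b ≠ a, (c b).1 < (c a).1) →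
      HasSum (fun k : ℕ => θ k * ∑ i, P k i (c a).2 * D (Function.update c a ((c a).1 - k, i)))
        (D c))
    (hcoin : ∀ c a b, a ≠ b → (c a).1 = (c b).1 → D c = 0)
    (hmarg : ∀ c a n, ∑ g, D (Function.update c a (n, g)) = 0) (c : ι → ℤ × G) : D c ≤ 0 := by
  classical
  have hG : Nonempty G := ⟨(c (Classical.arbitrary ι)).2⟩
  set S : ℕ → G → G → Prop := fun k g i => k ∈ A ∧ 0 < P k i g with hS
  have hSpos : ∀ k g i, S k g i → 0 < k := fun k _ _ h => hApos k h.1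
  set w : (ι → ℤ × G) → ℝ := fun c => ∏ e, lam (c e).2 with hw
  have hwpos : ∀ c, 0 < w c := fun c => Finset.prod_pos fun e _ => hlam _
  have hwup : ∀ c a n g, w (Function.update c a (n, g)) * lam (c a).2 = w c * lam g := by
    intro c a n g
    simp only [hw]
    rw [← Finset.mul_prod_erase _ _ (Finset.mem_univ a),
      ← Finset.mul_prod_erase _ (fun e => lam (c e).2) (Finset.mem_univ a)]
    have : ∏ e ∈ Finset.univ.erase a, lam (Function.update c a (n, g) e).2
        = ∏ e ∈ Finset.univ.erase a, lam (c e).2 :=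
      Finset.prod_congr rfl fun e he => by
        rw [Function.update_of_ne (Finset.ne_of_mem_erase he)]
    rw [this]
    simp only [Function.update_self]
    ring
  -- uniform bound for the normalised function
  obtain ⟨u₀, hu₀⟩ := Finite.exists_min fun u : ι → G => ∏ e, lam (u e)
  have hl : 0 < ∏ e, lam (u₀ e) := Finset.prod_pos fun e _ => hlam _
  have hbdd : BddAbove (Set.range fun c => D c / w c) := by
    refine ⟨B / ∏ e, lam (u₀ e), ?_⟩
    rintro _ ⟨c, rfl⟩
    have h0 : 0 ≤ B := (abs_nonneg _).trans (hB c)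
    exact div_le_div₀ h0 ((le_abs_self _).trans (hB c)) hl (hu₀ fun e => (c e).2)
  set M := ⨆ c, D c / w c with hMdef
  have hleM : ∀ c, D c / w c ≤ M := fun c => le_ciSup hbdd c
  by_contra! hc
  have hM : 0 < M := (div_pos hc (hwpos c)).trans_le (hleM c)
  set V : (ι → ℤ × G) → ℝ := fun c => M - D c / w c with hVdef
  have hV : ∀ c, 0 ≤ V c := fun c => sub_nonneg.2 (hleM c)
  have hpred' : ∀ g, ∃ k i, S k g i := fun g => by
    obtain ⟨k, e, i, -, hs, -⟩ := (hreach (n₀ + 1) (by omega) g g).exists_step (by omega)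
    exact ⟨k, i, hs⟩
  choose κ ip hκ using hpred'
  obtain ⟨K₀, hK₀⟩ := (Set.finite_range κ).bddAbove
  set K := max (2 * n₀) K₀
  obtain ⟨q, hq, hq1, hqle⟩ : ∃ q : ℝ, 0 < q ∧ q ≤ 1 ∧
      ∀ k ≤ K, ∀ g i, S k g i → q ≤ θ k * (lam i * P k i g) / lam g := by
    let F : Option (Fin (K + 1) × G × G) → ℝ := fun o => o.elim 1 fun t =>
      if S t.1 t.2.1 t.2.2 then θ t.1 * (lam t.2.2 * P t.1 t.2.2 t.2.1) / lam t.2.1 else 1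
    obtain ⟨t, ht⟩ := Finite.exists_min F
    refine ⟨F t, ?_, ht none, fun k hk g i hs => ?_⟩
    · rcases t with _ | t
      · exact one_pos
      · change 0 < ite _ _ _
        split_ifs with h
        · exact div_pos (mul_pos (hθpos _ h.1) (mul_pos (hlam _) h.2)) (hlam _)
        · exact one_pos
    · refine (ht (some (⟨k, by omega⟩, g, i))).trans_eq ?_
      change ite _ _ _ = _
      rw [if_pos hs]
  have hθP : ∀ k i g, 0 ≤ θ k * (lam i * P k i g) := fun k i g => by
    by_cases hk : k ∈ A
    · exact mul_nonneg (hθpos k hk).le (mul_nonneg (hlam i).le (hPnn k hk i g))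
    · simp [hθ0 k hk]
  have hstep : ∀ c a, (∀ b ≠ a, (c b).1 < (c a).1) → ∀ k ≤ K, ∀ i, S k (c a).2 i →
      q * V (Function.update c a ((c a).1 - k, i)) ≤ V c := by
    intro c a hca k hk i hs
    set g := (c a).2 with hg
    have hsum : HasSum (fun k : ℕ => ∑ i, θ k * (lam i * P k i g) *
        V (Function.update c a ((c a).1 - k, i))) (lam g * V c) := by
      have h1 := ((hinv g).mul_left M).sub ((hharm c a hca).mul_left (lam g / w c))
      have hwc := (hwpos c).ne'
      have hval : lam g * V c = M * lam g - lam g / w c * D c := by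
        simp only [hVdef]
        ring
      rw [hval]
      refine (congrArg (HasSum · _) (funext fun k => ?_)).mpr h1
      simp only [hVdef, Finset.mul_sum, ← Finset.sum_sub_distrib]
      refine Finset.sum_congr rfl fun i _ => ?_
      have h2 := hwup c a ((c a).1 - k) i
      have h3 := (hwpos (Function.update c a ((c a).1 - (k : ℤ), i))).ne'
      rw [← hg] at h2
      have h5 : lam i / w (Function.update c a ((c a).1 - (k : ℤ), i)) = lam g / w c := by
        rw [div_eq_div_iff h3 hwc]
        linarith
      rw [← h5]
      ring
    have hterm : ∀ k i, 0 ≤ θ k * (lam i * P k i g) *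
        V (Function.update c a ((c a).1 - (k : ℤ), i)) := fun k i => mul_nonneg (hθP k i g) (hV _)
    have h1 : θ k * (lam i * P k i g) * V (Function.update c a ((c a).1 - (k : ℤ), i))
        ≤ lam g * V c :=
      (Finset.single_le_sum (f := fun i => θ k * (lam i * P k i g) *
        V (Function.update c a ((c a).1 - (k : ℤ), i))) (fun i _ => hterm k i)
        (Finset.mem_univ i)).trans
      (le_hasSum hsum k fun k' _ => Finset.sum_nonneg fun i _ => hterm k' i)
    calc q * V (Function.update c a ((c a).1 - (k : ℤ), i))
        ≤ θ k * (lam i * P k i g) / lam g * V (Function.update c a ((c a).1 - (k : ℤ), i)) := by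
          gcongr
          · exact hV _
          · exact hqle k hk g i hs
      _ = θ k * (lam i * P k i g) * V (Function.update c a ((c a).1 - (k : ℤ), i)) / lam g := by
          ring
      _ ≤ V c := by
          rw [div_le_iff₀ (hlam g)]
          linarith
  obtain ⟨δ, hδ, hδV⟩ := exists_pos_mul_le hq hq1 hM.le hV hSpos
    (fun g => ⟨κ g, (hK₀ ⟨g, rfl⟩).trans (le_max_right _ _), ip g, hκ g⟩)
    (le_max_left _ _) hreach hstep
    (fun c a b hab h => by simp [hVdef, hcoin c a b hab h]) (fun g => (hlam g).le) hlam1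
    (fun c a n => by
      have h1 : ∀ g, lam g * V (Function.update c a (n, g)) = M * lam g
          - lam (c a).2 / w c * D (Function.update c a (n, g)) := fun g => by
        have h2 := hwup c a n g
        have h5 : lam g / w (Function.update c a (n, g)) = lam (c a).2 / w c := by
          rw [div_eq_div_iff (hwpos _).ne' (hwpos c).ne']
          linarith
        rw [← h5]
        simp only [hVdef]
        ring
      simp only [h1, Finset.sum_sub_distrib, ← Finset.mul_sum, hmarg, hlam1]
      ring)
  have hle : M ≤ M - δ * M := by
    have : Nonempty (ι → ℤ × G) := ⟨c⟩
    refine ciSup_le fun c => ?_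
    have := hδV c
    simp only [hVdef] at this
    linarith
  nlinarith [mul_pos hδ hM]

/-- A bounded function of finitely many walkers that is harmonic for the motion of the top walker,
vanishes on coincidences and has vanishing marginals, is zero. -/
theorem eq_zero_of_harmonic (hApos : ∀ k ∈ A, 0 < k) (hθpos : ∀ k ∈ A, 0 < θ k)
    (hθ0 : ∀ k, k ∉ A → θ k = 0) (hPnn : ∀ k ∈ A, ∀ i j : G, 0 ≤ P k i j)
    {n₀ : ℕ} (hreach : ∀ d ≥ n₀, ∀ g j, BackReach (fun k g i => k ∈ A ∧ 0 < P k i g) d g j)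
    (hlam : ∀ g, 0 < lam g) (hlam1 : ∑ g, lam g = 1)
    (hinv : ∀ g, HasSum (fun k => θ k * ∑ i, lam i * P k i g) (lam g))
    {D : (ι → ℤ × G) → ℝ} {B : ℝ} (hB : ∀ c, |D c| ≤ B)
    (hharm : ∀ c a, (∀ b ≠ a, (c b).1 < (c a).1) →
      HasSum (fun k : ℕ => θ k * ∑ i, P k i (c a).2 * D (Function.update c a ((c a).1 - k, i)))
        (D c))
    (hcoin : ∀ c a b, a ≠ b → (c a).1 = (c b).1 → D c = 0)
    (hmarg : ∀ c a n, ∑ g, D (Function.update c a (n, g)) = 0) (c : ι → ℤ × G) : D c = 0 := by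
  refine le_antisymm (nonpos_of_harmonic hApos hθpos hθ0 hPnn hreach hlam hlam1 hinv hB hharm hcoin
    hmarg c) ?_
  have := nonpos_of_harmonic (D := fun c => -D c) hApos hθpos hθ0 hPnn hreach hlam hlam1 hinv
    (by simpa using hB)
    (fun c a h => by simpa [Finset.sum_neg_distrib] using (hharm c a h).neg)
    (fun c a b hab h => by simp [hcoin c a b hab h]) (fun c a n => by simp [hmarg]) c
  simpa using this

end Harmonic

section Stationary

variable {G : Type*} [Fintype G]

/-- A stochastic matrix on a finite set has an invariant probability vector. -/
theorem exists_invariant_vector [DecidableEq G] [Nonempty G] {Q : G → G → ℝ}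
    (hQ : ∀ i j, 0 ≤ Q i j) (hQ1 : ∀ i, ∑ j, Q i j = 1) :
    ∃ lam : G → ℝ, (∀ g, 0 ≤ lam g) ∧ ∑ g, lam g = 1 ∧ ∀ g, ∑ i, lam i * Q i g = lam g := by
  have hdet : (Matrix.of Q - 1).det = 0 := by
    refine Matrix.exists_mulVec_eq_zero_iff.1 ⟨fun _ => 1, ?_, ?_⟩
    · exact fun h => one_ne_zero (congrFun h (Classical.arbitrary G))
    · ext i
      simp [Matrix.mulVec, dotProduct, hQ1, Matrix.one_apply]
  obtain ⟨v, hv0, hv⟩ := Matrix.exists_vecMul_eq_zero_iff.2 hdet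
  have hvQ : ∀ g, ∑ i, v i * Q i g = v g := fun g => by
    have := congrFun hv g
    simp only [Matrix.vecMul_sub, Matrix.vecMul_one, Pi.sub_apply, Pi.zero_apply] at this
    exact sub_eq_zero.1 this
  have hle : ∀ g ∈ Finset.univ, |v g| ≤ ∑ i, |v i| * Q i g := fun g _ => by
    calc |v g| = |∑ i, v i * Q i g| := by rw [hvQ]
      _ ≤ ∑ i, |v i * Q i g| := Finset.abs_sum_le_sum_abs _ _
      _ = ∑ i, |v i| * Q i g := by simp [abs_mul, abs_of_nonneg (hQ _ _)]
  have hsum : ∑ g, |v g| = ∑ g, ∑ i, |v i| * Q i g := by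
    rw [Finset.sum_comm]
    simp [← Finset.mul_sum, hQ1]
  have heq := (Finset.sum_eq_sum_iff_of_le hle).1 hsum
  have hpos : 0 < ∑ g, |v g| := by
    obtain ⟨g, hg⟩ := Function.ne_iff.1 hv0
    exact Finset.sum_pos' (fun _ _ => abs_nonneg _) ⟨g, Finset.mem_univ g, abs_pos.2 hg⟩
  refine ⟨fun g => |v g| / ∑ g, |v g|, fun g => by positivity, ?_, fun g => ?_⟩
  · rw [← Finset.sum_div, div_self hpos.ne']
  · beta_reduce
    rw [heq g (Finset.mem_univ g), Finset.sum_div]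
    exact Finset.sum_congr rfl fun i _ => by ring

variable {A : Set ℕ} {θ : ℕ → ℝ} {P : ℕ → G → G → ℝ}

theorem imitation_term_mem_Icc (hθpos : ∀ k ∈ A, 0 < θ k) (hθ0 : ∀ k, k ∉ A → θ k = 0)
    (hPnn : ∀ k ∈ A, ∀ i j : G, 0 ≤ P k i j) (hProw : ∀ k ∈ A, ∀ i : G, ∑ j, P k i j = 1)
    (k : ℕ) (i g : G) : θ k * P k i g ∈ Set.Icc 0 (θ k) := by
  by_cases hk : k ∈ A
  · refine ⟨mul_nonneg (hθpos k hk).le (hPnn k hk i g), ?_⟩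
    refine mul_le_of_le_one_right (hθpos k hk).le ?_
    rw [← hProw k hk i]
    exact Finset.single_le_sum (fun j _ => hPnn k hk i j) (Finset.mem_univ g)
  · simp [hθ0 k hk]

theorem summable_imitation (hθpos : ∀ k ∈ A, 0 < θ k) (hθ0 : ∀ k, k ∉ A → θ k = 0)
    (hθsum : HasSum θ 1)
    (hPnn : ∀ k ∈ A, ∀ i j : G, 0 ≤ P k i j) (hProw : ∀ k ∈ A, ∀ i : G, ∑ j, P k i j = 1)
    (f : ℕ → G) (g : G) : Summable fun k => θ k * P k (f k) g :=
  Summable.of_nonneg_of_le (fun k => (imitation_term_mem_Icc hθpos hθ0 hPnn hProw k _ _).1)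
    (fun k => (imitation_term_mem_Icc hθpos hθ0 hPnn hProw k _ _).2) hθsum.summable

theorem sum_tsum_imitation (hθpos : ∀ k ∈ A, 0 < θ k) (hθ0 : ∀ k, k ∉ A → θ k = 0)
    (hθsum : HasSum θ 1)
    (hPnn : ∀ k ∈ A, ∀ i j : G, 0 ≤ P k i j) (hProw : ∀ k ∈ A, ∀ i : G, ∑ j, P k i j = 1)
    (f : ℕ → G) : ∑ g, ∑' k, θ k * P k (f k) g = 1 := by
  have h := hasSum_sum fun g (_ : g ∈ Finset.univ) =>
    (summable_imitation hθpos hθ0 hθsum hPnn hProw f g).hasSum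
  have h1 : (fun k => ∑ g, θ k * P k (f k) g) = θ := by
    funext k
    rw [← Finset.mul_sum]
    by_cases hk : k ∈ A
    · rw [hProw k hk, mul_one]
    · rw [hθ0 k hk, zero_mul]
  rw [h1] at h
  exact h.unique hθsum

/-- The series for the image of a vector under the averaged matrix converges. -/
theorem hasSum_invariant (hθpos : ∀ k ∈ A, 0 < θ k) (hθ0 : ∀ k, k ∉ A → θ k = 0)
    (hθsum : HasSum θ 1)
    (hPnn : ∀ k ∈ A, ∀ i j : G, 0 ≤ P k i j) (hProw : ∀ k ∈ A, ∀ i : G, ∑ j, P k i j = 1)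
    (lam : G → ℝ) (g : G) :
    HasSum (fun k => θ k * ∑ i, lam i * P k i g) (∑ i, lam i * ∑' k, θ k * P k i g) := by
  have h := hasSum_sum fun i (_ : i ∈ Finset.univ) =>
    ((summable_imitation hθpos hθ0 hθsum hPnn hProw (fun _ => i) g).hasSum.mul_left (lam i))
  refine (congrArg (HasSum · _) (funext fun k => ?_)).mpr h
  rw [Finset.mul_sum]
  exact Finset.sum_congr rfl fun i _ => by ring

theorem invariant_pos (hθpos : ∀ k ∈ A, 0 < θ k) (hθ0 : ∀ k, k ∉ A → θ k = 0)
    (hPnn : ∀ k ∈ A, ∀ i j : G, 0 ≤ P k i j)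
    (hreach : ∀ g j, ∃ d, BackReach (fun k g i => k ∈ A ∧ 0 < P k i g) d g j)
    {lam : G → ℝ} (hlam : ∀ g, 0 ≤ lam g) (hlam1 : ∑ g, lam g = 1)
    (hinv : ∀ g, HasSum (fun k => θ k * ∑ i, lam i * P k i g) (lam g)) (g : G) : 0 < lam g := by
  obtain ⟨j, -, hj⟩ : ∃ j ∈ Finset.univ, 0 < lam j := by
    refine Finset.exists_lt_of_sum_lt (f := fun _ => 0) ?_
    simp [hlam1]
  obtain ⟨d, hd⟩ := hreach g j
  induction hd with
  | refl => exact hj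
  | @step k d g i j hs _ ih =>
    have hi := ih hj
    have h1 : 0 < θ k * ∑ i, lam i * P k i g :=
      mul_pos (hθpos k hs.1) (Finset.sum_pos' (fun i _ => mul_nonneg (hlam i) (hPnn k hs.1 i g))
        ⟨i, Finset.mem_univ i, mul_pos hi hs.2⟩)
    refine h1.trans_le (le_hasSum (hinv g) k fun k' _ => ?_)
    by_cases hk : k' ∈ A
    · exact mul_nonneg (hθpos k' hk).le
        (Finset.sum_nonneg fun i _ => mul_nonneg (hlam i) (hPnn k' hk i g))
    · simp [hθ0 k' hk]

theorem backReach_of_wordK_pos [DecidableEq G] (hPnn : ∀ k ∈ A, ∀ i j : G, 0 ≤ P k i j)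
    {l : List ℕ} (hl : ∀ a ∈ l, a ∈ A) {i j : G} (h : 0 < wordK P l i j) :
    BackReach (fun k g i => k ∈ A ∧ 0 < P k i g) l.sum j i := by
  induction l generalizing j with
  | nil =>
    simp only [wordK] at h
    split_ifs at h with hij
    · subst hij; exact .refl i
    · exact absurd h (lt_irrefl 0)
  | cons a l ih =>
    simp only [wordK] at h
    obtain ⟨m, -, hm⟩ : ∃ m ∈ Finset.univ, 0 < wordK P l i m * P a m j := by
      refine Finset.exists_lt_of_sum_lt (f := fun _ => 0) ?_
      simpa using h
    have ha := hl a (by simp)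
    have hP : 0 < P a m j := lt_of_le_of_ne (hPnn a ha m j) fun h0 => by simp [← h0] at hm
    rw [List.sum_cons]
    exact .step ⟨ha, hP⟩ (ih (fun b hb => hl b (by simp [hb])) (pos_of_mul_pos_left hm hP.le))

end Stationary

section Uniqueness

variable {ι G : Type*}

/-- The cylinder event that the site `(c a).1` carries the state `(c a).2` for every `a`. -/
def walkerCylinder (c : ι → ℤ × G) : Set (ℤ → G) := {x | ∀ a, x (c a).1 = (c a).2}

theorem walkerCylinder_update [DecidableEq ι] (c : ι → ℤ × G) (a : ι) (n : ℤ) (g : G) :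
    walkerCylinder (Function.update c a (n, g))
      = {x | ∀ b, b ≠ a → x (c b).1 = (c b).2} ∩ {x | x n = g} := by
  ext x
  constructor
  · intro h
    exact ⟨fun b hb => by simpa [hb] using h b, by simpa using h a⟩
  · rintro ⟨h, h'⟩ b
    by_cases hb : b = a
    · subst hb
      simpa using h'
    · simpa [hb] using h b hb

theorem walkerCylinder_eq_inter {N : ℕ} (c : Fin (N + 1) → ℤ × G) (a : Fin (N + 1)) :
    {x : ℤ → G | ∀ b, b ≠ a → x (c b).1 = (c b).2} = walkerCylinder (c ∘ a.succAbove) := by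
  ext x
  constructor
  · exact fun h b => h _ (a.succAbove_ne b)
  · intro h b hb
    obtain ⟨e, rfl⟩ := Fin.exists_succAbove_eq hb
    exact h e

variable [MeasurableSpace G]

theorem measurableSet_coord_eq [MeasurableSingletonClass G] (n : ℤ) (g : G) :
    MeasurableSet {x : ℤ → G | x n = g} :=
  (measurable_pi_apply n : Measurable fun x : ℤ → G => x n) (measurableSet_singleton g)

theorem PastMeasurable.measurableSet {n : ℤ} {E : Set (ℤ → G)} (hE : PastMeasurable n E) :
    MeasurableSet E := by
  obtain ⟨T, hT, rfl⟩ := hE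
  exact (measurable_pi_lambda _ fun m => measurable_pi_apply _) hT

theorem PastMeasurable.congr {n : ℤ} {E : Set (ℤ → G)} (hE : PastMeasurable n E) {x y : ℤ → G}
    (h : ∀ m < n, x m = y m) : x ∈ E ↔ y ∈ E := by
  obtain ⟨T, hT, rfl⟩ := hE
  have : (fun m : {m : ℤ // m < n} => x m.1) = fun m => y m.1 := funext fun m => h m.1 m.2
  simp [this]

theorem pastMeasurable_others [MeasurableSingletonClass G] [Countable ι] {n : ℤ}
    (c : ι → ℤ × G) (a : ι) (h : ∀ b ≠ a, (c b).1 < n) :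
    PastMeasurable n {x : ℤ → G | ∀ b, b ≠ a → x (c b).1 = (c b).2} := by
  refine ⟨⋂ b, ⋂ hb : b ≠ a, {y | y ⟨(c b).1, h b hb⟩ = (c b).2}, ?_, ?_⟩
  · exact MeasurableSet.iInter fun b => MeasurableSet.iInter fun hb =>
      measurable_pi_apply _ (measurableSet_singleton _)
  · ext x
    simp

theorem measurableSet_walkerCylinder [MeasurableSingletonClass G] [Countable ι] (c : ι → ℤ × G) :
    MeasurableSet (walkerCylinder c) := by
  have : walkerCylinder c = ⋂ a, {x | x (c a).1 = (c a).2} := by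
    ext x
    simp [walkerCylinder]
  rw [this]
  exact MeasurableSet.iInter fun a => measurableSet_coord_eq _ _

variable [Fintype G] [MeasurableSingletonClass G]
  {A : Set ℕ} {θ : ℕ → ℝ} {P : ℕ → G → G → ℝ}

theorem sum_measureReal_inter_coord (μ : Measure (ℤ → G)) [IsFiniteMeasure μ] (n : ℤ)
    {E : Set (ℤ → G)} (hE : MeasurableSet E) :
    ∑ g, μ.real (E ∩ {x | x n = g}) = μ.real E := by
  rw [← measureReal_biUnion_finset]
  · congr 1
    ext x
    simp
  · intro g _ g' _ hgg'
    refine Set.disjoint_left.2 fun x hx hx' => hgg' ?_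
    exact hx.2.symm.trans hx'.2
  · exact fun g _ => hE.inter (measurableSet_coord_eq n g)

/-- Compatibility, written as a convergent expansion over the copied site. -/
theorem Compatible.hasSum (hθpos : ∀ k ∈ A, 0 < θ k) (hθ0 : ∀ k, k ∉ A → θ k = 0)
    (hθsum : HasSum θ 1)
    (hPnn : ∀ k ∈ A, ∀ i j : G, 0 ≤ P k i j) (hProw : ∀ k ∈ A, ∀ i : G, ∑ j, P k i j = 1)
    {μ : Measure (ℤ → G)} [IsProbabilityMeasure μ] (hμ : Compatible θ P μ) (n : ℤ) (g : G)
    {E : Set (ℤ → G)} (hE : PastMeasurable n E) :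
    HasSum (fun k : ℕ => θ k * ∑ i, P k i g * μ.real (E ∩ {x | x (n - k) = i}))
      (μ.real (E ∩ {x | x n = g})) := by
  have hIcc := imitation_term_mem_Icc hθpos hθ0 hPnn hProw
  have hint : ∀ k : ℕ, Integrable (fun x : ℤ → G => θ k * P k (x (n - k)) g) (μ.restrict E) :=
    fun k => Integrable.of_bound
      (((Measurable.of_discrete (f := fun i => θ k * P k i g)).comp
        (measurable_pi_apply (n - (k : ℤ)))).aestronglyMeasurable) (θ k)
      (Filter.Eventually.of_forall fun x => by
        rw [Real.norm_of_nonneg (hIcc k _ g).1]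
        exact (hIcc k _ g).2)
  have hval : ∀ k : ℕ, ∫ x in E, θ k * P k (x (n - k)) g ∂μ
      = θ k * ∑ i, P k i g * μ.real (E ∩ {x | x (n - k) = i}) := by
    intro k
    have h1 : (fun x : ℤ → G => θ k * P k (x (n - k)) g)
        = fun x => ∑ i, {x : ℤ → G | x (n - k) = i}.indicator (fun _ => θ k * P k i g) x := by
      funext x
      rw [Finset.sum_eq_single (x (n - k))]
      · simp
      · intro i _ hi
        exact Set.indicator_of_notMem (s := {x : ℤ → G | x (n - k) = i}) (fun h => hi (Eq.symm h)) _
      · simp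
    rw [h1, integral_finsetSum]
    · rw [Finset.mul_sum]
      refine Finset.sum_congr rfl fun i _ => ?_
      rw [integral_indicator_const _ (measurableSet_coord_eq _ _),
        measureReal_restrict_apply (measurableSet_coord_eq _ _), Set.inter_comm, smul_eq_mul]
      ring
    · exact fun i _ => (integrable_const _).indicator (measurableSet_coord_eq _ _)
  have h := hasSum_integral_of_summable_integral_norm hint (by
    refine Summable.of_nonneg_of_le (fun k => integral_nonneg fun x => norm_nonneg _) (fun k => ?_)
      hθsum.summable
    calc ∫ x in E, ‖θ k * P k (x (n - k)) g‖ ∂μ ≤ ∫ _x in E, θ k ∂μ := by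
          refine integral_mono (hint k).norm (integrable_const _) fun x => ?_
          simp only
          rw [Real.norm_of_nonneg (hIcc k _ g).1]
          exact (hIcc k _ g).2
      _ ≤ θ k := by
          rw [integral_const, smul_eq_mul, measureReal_restrict_apply_univ]
          exact mul_le_of_le_one_left ((hIcc k g g).1.trans (hIcc k g g).2) measureReal_le_one)
  simp only [hval] at h
  rwa [← hμ n g E hE] at h

theorem Compatible.hasSum_walkerCylinder [Countable ι] [DecidableEq ι]
    (hθpos : ∀ k ∈ A, 0 < θ k) (hθ0 : ∀ k, k ∉ A → θ k = 0) (hθsum : HasSum θ 1)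
    (hPnn : ∀ k ∈ A, ∀ i j : G, 0 ≤ P k i j) (hProw : ∀ k ∈ A, ∀ i : G, ∑ j, P k i j = 1)
    {μ : Measure (ℤ → G)} [IsProbabilityMeasure μ] (hμ : Compatible θ P μ)
    (c : ι → ℤ × G) (a : ι) (hc : ∀ b ≠ a, (c b).1 < (c a).1) :
    HasSum (fun k : ℕ => θ k * ∑ i, P k i (c a).2 *
        μ.real (walkerCylinder (Function.update c a ((c a).1 - k, i))))
      (μ.real (walkerCylinder c)) := by
  have h := hμ.hasSum hθpos hθ0 hθsum hPnn hProw (c a).1 (c a).2 (pastMeasurable_others c a hc)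
  simp only [← walkerCylinder_update] at h
  simpa using h

theorem Compatible.measureReal_walkerCylinder_eq
    (hApos : ∀ k ∈ A, 0 < k) (hθpos : ∀ k ∈ A, 0 < θ k)
    (hθ0 : ∀ k, k ∉ A → θ k = 0) (hθsum : HasSum θ 1)
    (hPnn : ∀ k ∈ A, ∀ i j : G, 0 ≤ P k i j) (hProw : ∀ k ∈ A, ∀ i : G, ∑ j, P k i j = 1)
    {n₀ : ℕ} (hreach : ∀ d ≥ n₀, ∀ g j, BackReach (fun k g i => k ∈ A ∧ 0 < P k i g) d g j)
    {lam : G → ℝ} (hlam : ∀ g, 0 < lam g) (hlam1 : ∑ g, lam g = 1)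
    (hinv : ∀ g, HasSum (fun k => θ k * ∑ i, lam i * P k i g) (lam g))
    {μ ν : Measure (ℤ → G)} [IsProbabilityMeasure μ] [IsProbabilityMeasure ν]
    (hμ : Compatible θ P μ) (hν : Compatible θ P ν) {N : ℕ} (c : Fin N → ℤ × G) :
    μ.real (walkerCylinder c) = ν.real (walkerCylinder c) := by
  induction N with
  | zero =>
    have : walkerCylinder c = Set.univ := Set.eq_univ_of_forall fun x a => a.elim0
    simp [this]
  | succ N ih =>
    refine sub_eq_zero.1 (eq_zero_of_harmonic hApos hθpos hθ0 hPnn hreach hlam hlam1 hinv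
      (D := fun c => μ.real (walkerCylinder c) - ν.real (walkerCylinder c)) (B := 1)
      (fun c => ?_) (fun c a hc => ?_) (fun c a b hab h => ?_) (fun c a n => ?_) c)
    · have h1 := measureReal_nonneg (μ := μ) (s := walkerCylinder c)
      have h2 := measureReal_nonneg (μ := ν) (s := walkerCylinder c)
      have h3 := measureReal_le_one (μ := μ) (s := walkerCylinder c)
      have h4 := measureReal_le_one (μ := ν) (s := walkerCylinder c)
      exact abs_sub_le_iff.2 ⟨by linarith, by linarith⟩
    · simp only [mul_sub, Finset.sum_sub_distrib]
      exact (hμ.hasSum_walkerCylinder hθpos hθ0 hθsum hPnn hProw c a hc).sub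
        (hν.hasSum_walkerCylinder hθpos hθ0 hθsum hPnn hProw c a hc)
    · by_cases h2 : (c a).2 = (c b).2
      · have : walkerCylinder c = walkerCylinder (c ∘ a.succAbove) := by
          rw [← walkerCylinder_eq_inter]
          ext x
          refine ⟨fun hx e _ => hx e, fun hx e => ?_⟩
          by_cases he : e = a
          · rw [he, h, h2]
            exact hx b hab.symm
          · exact hx e he
        rw [this, ih, sub_self]
      · have : walkerCylinder c = ∅ := by
          refine Set.eq_empty_of_forall_notMem fun x hx => h2 ?_
          rw [← hx a, ← hx b, h]
        simp [this]
    · simp only [walkerCylinder_update, walkerCylinder_eq_inter, Finset.sum_sub_distrib]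
      rw [sum_measureReal_inter_coord _ _ (measurableSet_walkerCylinder _),
        sum_measureReal_inter_coord _ _ (measurableSet_walkerCylinder _), ih, sub_self]

theorem measure_eq_of_walkerCylinder {μ ν : Measure (ℤ → G)} [IsFiniteMeasure μ] [IsFiniteMeasure ν]
    (h : ∀ (N : ℕ) (c : Fin N → ℤ × G),
      μ.real (walkerCylinder c) = ν.real (walkerCylinder c)) : μ = ν := by
  refine IsProjectiveLimit.unique (P := fun I => ν.map I.restrict) (fun I => ?_) fun I => rfl
  refine Measure.ext_of_singleton fun y => ?_
  rw [Measure.map_apply (Finset.measurable_restrict I) (measurableSet_singleton y),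
    Measure.map_apply (Finset.measurable_restrict I) (measurableSet_singleton y)]
  have h1 : {x : ℤ → G | I.restrict x = y} = walkerCylinder
      fun a : Fin (Fintype.card I) => ((((Fintype.equivFin I).symm a : I) : ℤ),
        y ((Fintype.equivFin I).symm a)) := by
    ext x
    constructor
    · rintro rfl a
      rfl
    · intro hx
      funext i
      obtain ⟨a, rfl⟩ := (Fintype.equivFin I).symm.surjective i
      exact hx a
  change μ {x : ℤ → G | I.restrict x = y} = ν {x : ℤ → G | I.restrict x = y}
  rw [h1]
  exact (measureReal_eq_measureReal_iff).1 (h _ _)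

/-- The single-site marginals of a compatible measure are given by the invariant vector. -/
theorem Compatible.measureReal_coord
    (hApos : ∀ k ∈ A, 0 < k) (hθpos : ∀ k ∈ A, 0 < θ k)
    (hθ0 : ∀ k, k ∉ A → θ k = 0) (hθsum : HasSum θ 1)
    (hPnn : ∀ k ∈ A, ∀ i j : G, 0 ≤ P k i j) (hProw : ∀ k ∈ A, ∀ i : G, ∑ j, P k i j = 1)
    {n₀ : ℕ} (hreach : ∀ d ≥ n₀, ∀ g j, BackReach (fun k g i => k ∈ A ∧ 0 < P k i g) d g j)
    {lam : G → ℝ} (hlam : ∀ g, 0 < lam g) (hlam1 : ∑ g, lam g = 1)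
    (hinv : ∀ g, HasSum (fun k => θ k * ∑ i, lam i * P k i g) (lam g))
    {μ : Measure (ℤ → G)} [IsProbabilityMeasure μ] (hμ : Compatible θ P μ) (n : ℤ) (g : G) :
    μ.real {x | x n = g} = lam g := by
  have key := eq_zero_of_harmonic (ι := Fin 1) hApos hθpos hθ0 hPnn hreach hlam hlam1 hinv
    (D := fun c => μ.real (walkerCylinder c) - lam (c 0).2) (B := 1)
    (fun c => ?_) (fun c a hc => ?_) (fun c a b hab h => absurd (Subsingleton.elim a b) hab)
    (fun c a n => ?_) fun _ => (n, g)
  · simpa [walkerCylinder, sub_eq_zero] using key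
  · have h1 := measureReal_nonneg (μ := μ) (s := walkerCylinder c)
    have h3 := measureReal_le_one (μ := μ) (s := walkerCylinder c)
    have h2 := (hlam (c 0).2).le
    have h4 : lam (c 0).2 ≤ 1 := by
      rw [← hlam1]
      exact Finset.single_le_sum (fun g _ => (hlam g).le) (Finset.mem_univ _)
    exact abs_sub_le_iff.2 ⟨by linarith, by linarith⟩
  · obtain rfl : a = 0 := Subsingleton.elim _ _
    simp only [mul_sub, Finset.sum_sub_distrib]
    refine (hμ.hasSum_walkerCylinder hθpos hθ0 hθsum hPnn hProw c 0 hc).sub ?_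
    simpa [mul_comm] using hinv (c 0).2
  · obtain rfl : a = 0 := Subsingleton.elim _ _
    simp only [walkerCylinder_update, walkerCylinder_eq_inter, Finset.sum_sub_distrib]
    rw [sum_measureReal_inter_coord _ _ (measurableSet_walkerCylinder _)]
    have : walkerCylinder (c ∘ (0 : Fin 1).succAbove) = Set.univ :=
      Set.eq_univ_of_forall fun x a => a.elim0
    rw [this]
    simp [hlam1]

end Uniqueness

section Existence

variable {G : Type*}

/-- The conditional probability of the state `g` at site `n` given the configuration `x`. -/
noncomputable def imitationKernel (θ : ℕ → ℝ) (P : ℕ → G → G → ℝ) (n : ℤ) (g : G)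
    (x : ℤ → G) : ℝ := ∑' k : ℕ, θ k * P k (x (n - (k : ℤ))) g

theorem imitationKernel_congr {θ : ℕ → ℝ} {P : ℕ → G → G → ℝ} (h0 : θ 0 = 0) (n : ℤ) (g : G)
    {x y : ℤ → G} (h : ∀ m < n, x m = y m) :
    imitationKernel θ P n g x = imitationKernel θ P n g y := by
  refine tsum_congr fun k => ?_
  rcases Nat.eq_zero_or_pos k with rfl | hk
  · simp [h0]
  · rw [h _ (by omega)]

/-- Compatibility at the single site `n`, with the integral taken in `[0, ∞]`. -/
def CompatibleAt [MeasurableSpace G] (θ : ℕ → ℝ) (P : ℕ → G → G → ℝ) (n : ℤ)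
    (μ : Measure (ℤ → G)) : Prop :=
  ∀ (g : G) (E : Set (ℤ → G)), PastMeasurable n E →
    μ (E ∩ {x | x n = g}) = ∫⁻ x in E, ENNReal.ofReal (imitationKernel θ P n g x) ∂μ

/-- Draw the state of the site `n` anew from the imitation kernel. -/
noncomputable def resample [MeasurableSpace G] [Fintype G] (θ : ℕ → ℝ) (P : ℕ → G → G → ℝ) (n : ℤ)
    (μ : Measure (ℤ → G)) : Measure (ℤ → G) :=
  ∑ g, (μ.withDensity fun x => ENNReal.ofReal (imitationKernel θ P n g x)).map
    fun x => Function.update x n g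

theorem measurable_update_coord [MeasurableSpace G] (n : ℤ) (g : G) :
    Measurable fun x : ℤ → G => Function.update x n g := by
  refine measurable_pi_lambda _ fun m => ?_
  by_cases h : m = n
  · subst h
    simp
  · simpa [h] using measurable_pi_apply m

theorem isClopen_coord_eq [TopologicalSpace G] [DiscreteTopology G] (n : ℤ) (g : G) :
    IsClopen {x : ℤ → G | x n = g} :=
  (isClopen_discrete {g}).preimage (continuous_apply n)

variable [Fintype G] {A : Set ℕ} {θ : ℕ → ℝ} {P : ℕ → G → G → ℝ}

theorem imitationKernel_nonneg (hθpos : ∀ k ∈ A, 0 < θ k) (hθ0 : ∀ k, k ∉ A → θ k = 0)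
    (hPnn : ∀ k ∈ A, ∀ i j : G, 0 ≤ P k i j) (hProw : ∀ k ∈ A, ∀ i : G, ∑ j, P k i j = 1)
    (n : ℤ) (g : G) (x : ℤ → G) : 0 ≤ imitationKernel θ P n g x :=
  tsum_nonneg fun k => (imitation_term_mem_Icc hθpos hθ0 hPnn hProw k _ _).1

theorem sum_ofReal_imitationKernel (hθpos : ∀ k ∈ A, 0 < θ k) (hθ0 : ∀ k, k ∉ A → θ k = 0)
    (hθsum : HasSum θ 1)
    (hPnn : ∀ k ∈ A, ∀ i j : G, 0 ≤ P k i j) (hProw : ∀ k ∈ A, ∀ i : G, ∑ j, P k i j = 1)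
    (n : ℤ) (x : ℤ → G) : ∑ g, ENNReal.ofReal (imitationKernel θ P n g x) = 1 := by
  rw [← ENNReal.ofReal_sum_of_nonneg fun g _ =>
    imitationKernel_nonneg hθpos hθ0 hPnn hProw n g x]
  simp only [imitationKernel]
  rw [sum_tsum_imitation hθpos hθ0 hθsum hPnn hProw fun k => x (n - (k : ℤ)), ENNReal.ofReal_one]

theorem continuous_imitationKernel [TopologicalSpace G] [DiscreteTopology G]
    (hθpos : ∀ k ∈ A, 0 < θ k) (hθ0 : ∀ k, k ∉ A → θ k = 0) (hθsum : HasSum θ 1)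
    (hPnn : ∀ k ∈ A, ∀ i j : G, 0 ≤ P k i j) (hProw : ∀ k ∈ A, ∀ i : G, ∑ j, P k i j = 1)
    (n : ℤ) (g : G) : Continuous (imitationKernel θ P n g) := by
  refine continuous_tsum (fun k => ?_) hθsum.summable fun k x => ?_
  · exact (continuous_of_discreteTopology (f := fun i => θ k * P k i g)).comp
      (continuous_apply (n - (k : ℤ)))
  · have := imitation_term_mem_Icc hθpos hθ0 hPnn hProw k (x (n - k)) g
    rw [Real.norm_of_nonneg this.1]
    exact this.2

variable [MeasurableSpace G]

theorem lintegral_resample {n : ℤ} (hmeas : ∀ g, Measurable (imitationKernel θ P n g))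
    (μ : Measure (ℤ → G)) {f : (ℤ → G) → ENNReal} (hf : Measurable f) :
    ∫⁻ x, f x ∂(resample θ P n μ)
      = ∑ g, ∫⁻ x, ENNReal.ofReal (imitationKernel θ P n g x) * f (Function.update x n g) ∂μ := by
  rw [resample, lintegral_finsetSum_measure]
  refine Finset.sum_congr rfl fun g _ => ?_
  rw [lintegral_map hf (measurable_update_coord n g)]
  exact lintegral_withDensity_eq_lintegral_mul _ (hmeas g).ennreal_ofReal
    (hf.comp (measurable_update_coord n g))

theorem lintegral_resample_of_invariant {n : ℤ}
    (hmeas : ∀ g, Measurable (imitationKernel θ P n g))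
    (hsum : ∀ x, ∑ g, ENNReal.ofReal (imitationKernel θ P n g x) = 1)
    (μ : Measure (ℤ → G)) {f : (ℤ → G) → ENNReal} (hf : Measurable f)
    (hinv : ∀ x g, f (Function.update x n g) = f x) :
    ∫⁻ x, f x ∂(resample θ P n μ) = ∫⁻ x, f x ∂μ := by
  rw [lintegral_resample hmeas μ hf, ← lintegral_finsetSum]
  · simp only [hinv, ← Finset.sum_mul, hsum, one_mul]
  · exact fun g _ => (hmeas g).ennreal_ofReal.mul (hf.comp (measurable_update_coord n g))

theorem isProbabilityMeasure_resample {n : ℤ}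
    (hmeas : ∀ g, Measurable (imitationKernel θ P n g))
    (hsum : ∀ x, ∑ g, ENNReal.ofReal (imitationKernel θ P n g x) = 1)
    (μ : Measure (ℤ → G)) [IsProbabilityMeasure μ] : IsProbabilityMeasure (resample θ P n μ) := by
  constructor
  have := lintegral_resample_of_invariant hmeas hsum μ (f := fun _ => 1) measurable_const
    fun _ _ => rfl
  simpa using this

theorem lintegral_past_resample (h0 : θ 0 = 0) (hmeas : ∀ n g, Measurable (imitationKernel θ P n g))
    (hsum : ∀ n x, ∑ g, ENNReal.ofReal (imitationKernel θ P n g x) = 1)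
    (μ : Measure (ℤ → G)) {m n : ℤ} (hmn : m ≤ n) (g : G) {E : Set (ℤ → G)}
    (hE : PastMeasurable m E) :
    ∫⁻ x in E, ENNReal.ofReal (imitationKernel θ P m g x) ∂(resample θ P n μ)
      = ∫⁻ x in E, ENNReal.ofReal (imitationKernel θ P m g x) ∂μ := by
  rw [← lintegral_indicator hE.measurableSet, ← lintegral_indicator hE.measurableSet]
  refine lintegral_resample_of_invariant (hmeas n) (hsum n) μ
    ((hmeas m g).ennreal_ofReal.indicator hE.measurableSet) fun x h => ?_
  have hx : ∀ l < m, Function.update x n h l = x l := fun l hl =>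
    Function.update_of_ne (by omega) _ _
  have h1 := hE.congr hx
  by_cases hxE : x ∈ E
  · rw [Set.indicator_of_mem hxE, Set.indicator_of_mem (h1.2 hxE), imitationKernel_congr h0 m g hx]
  · rw [Set.indicator_of_notMem hxE, Set.indicator_of_notMem (mt h1.1 hxE)]

theorem isClosed_setOf_measure_eq_integral [TopologicalSpace G] [DiscreteTopology G]
    [BorelSpace G] {E F : Set (ℤ → G)} (hE : IsClopen E)
    (hF : IsClopen F) {f : (ℤ → G) → ℝ} (hf : Continuous f) :
    IsClosed {μ : ProbabilityMeasure (ℤ → G) |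
      (μ : Measure (ℤ → G)).real F = ∫ x in E, f x ∂(μ : Measure (ℤ → G))} := by
  have hc := fun f : C(ℤ → G, ℝ) =>
    ProbabilityMeasure.continuous_iff_forall_continuousMap_continuous_integral.1
      (continuous_id (X := ProbabilityMeasure (ℤ → G))) f
  refine isClosed_eq ?_ ?_
  · have := hc ⟨F.indicator 1, hF.continuous_indicator continuous_one⟩
    simpa only [ContinuousMap.coe_mk, id, integral_indicator_one hF.isOpen.measurableSet] using this
  · have := hc ⟨E.indicator f, hE.continuous_indicator hf⟩
    simpa only [ContinuousMap.coe_mk, id, integral_indicator hE.isOpen.measurableSet] using this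

variable [MeasurableSingletonClass G]

theorem compatibleAt_resample_self (h0 : θ 0 = 0)
    (hmeas : ∀ n g, Measurable (imitationKernel θ P n g))
    (hsum : ∀ n x, ∑ g, ENNReal.ofReal (imitationKernel θ P n g x) = 1)
    (μ : Measure (ℤ → G)) (n : ℤ) : CompatibleAt θ P n (resample θ P n μ) := by
  intro g E hE
  have hB := hE.measurableSet.inter (measurableSet_coord_eq n g)
  rw [lintegral_past_resample h0 hmeas hsum μ le_rfl g hE, ← lintegral_indicator_one hB,
    lintegral_resample (hmeas n) μ (measurable_one.indicator hB), Finset.sum_eq_single g,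
    ← lintegral_indicator hE.measurableSet]
  · refine lintegral_congr fun x => ?_
    have h1 : Function.update x n g ∈ E ↔ x ∈ E := hE.congr fun m hm =>
      Function.update_of_ne (by omega) _ _
    by_cases hxE : x ∈ E
    · have hmem : Function.update x n g ∈ E ∩ {x | x n = g} := ⟨h1.2 hxE, by simp⟩
      rw [Set.indicator_of_mem hxE, Set.indicator_of_mem hmem, Pi.one_apply, mul_one]
    · rw [Set.indicator_of_notMem hxE, Set.indicator_of_notMem fun h => hxE (h1.1 h.1), mul_zero]
  · intro h _ hhg
    have : ∀ x : ℤ → G, Function.update x n h ∉ E ∩ {x | x n = g} := fun x hx =>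
      hhg (by simpa using hx.2)
    simp [Set.indicator_of_notMem (this _)]
  · simp

theorem CompatibleAt.resample (h0 : θ 0 = 0)
    (hmeas : ∀ n g, Measurable (imitationKernel θ P n g))
    (hsum : ∀ n x, ∑ g, ENNReal.ofReal (imitationKernel θ P n g x) = 1)
    {μ : Measure (ℤ → G)} {m n : ℤ} (hmn : m < n) (hμ : CompatibleAt θ P m μ) :
    CompatibleAt θ P m (resample θ P n μ) := by
  intro g E hE
  rw [lintegral_past_resample h0 hmeas hsum μ hmn.le g hE, ← hμ g E hE]
  have hB := hE.measurableSet.inter (measurableSet_coord_eq m g)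
  rw [← lintegral_indicator_one hB, ← lintegral_indicator_one hB]
  refine lintegral_resample_of_invariant (hmeas n) (hsum n) μ (measurable_one.indicator hB)
    fun x h => ?_
  have h1 : Function.update x n h ∈ E ∩ {x | x m = g} ↔ x ∈ E ∩ {x | x m = g} := by
    refine and_congr (hE.congr fun l hl => Function.update_of_ne (by omega) _ _) ?_
    simp [hmn.ne]
  by_cases hx : x ∈ E ∩ {x | x m = g}
  · rw [Set.indicator_of_mem hx, Set.indicator_of_mem (h1.2 hx)]
    rfl
  · rw [Set.indicator_of_notMem hx, Set.indicator_of_notMem (mt h1.1 hx)]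

theorem exists_compatibleAt_window [Nonempty G] (h0 : θ 0 = 0)
    (hmeas : ∀ n g, Measurable (imitationKernel θ P n g))
    (hsum : ∀ n x, ∑ g, ENNReal.ofReal (imitationKernel θ P n g x) = 1) (L : ℤ) (j : ℕ) :
    ∃ μ : Measure (ℤ → G), IsProbabilityMeasure μ ∧
      ∀ m, L ≤ m → m < L + j → CompatibleAt θ P m μ := by
  induction j with
  | zero =>
    exact ⟨Measure.dirac fun _ => Classical.arbitrary G, inferInstance,
      fun m h1 h2 => by push_cast at h2; omega⟩
  | succ j ih =>
    obtain ⟨μ, hμ, h⟩ := ih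
    refine ⟨resample θ P (L + j) μ, isProbabilityMeasure_resample (hmeas _) (hsum _) μ,
      fun m h1 h2 => ?_⟩
    rcases eq_or_ne m (L + j) with rfl | hm
    · exact compatibleAt_resample_self h0 hmeas hsum μ _
    · push_cast at h2
      exact (h m h1 (by omega)).resample h0 hmeas hsum (by omega)

section Topological

variable [TopologicalSpace G] [DiscreteTopology G]

/-- The clopen events generate the past. -/
theorem past_eq_generateFrom_isClopen (n : ℤ) :
    MeasurableSpace.comap (fun x : ℤ → G => fun m : {m : ℤ // m < n} => x m.1) MeasurableSpace.pi
      = MeasurableSpace.generateFrom {E | IsClopen E ∧ PastMeasurable n E} := by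
  refine le_antisymm ?_ (MeasurableSpace.generateFrom_le fun E hE => hE.2)
  rw [← measurable_iff_comap_le]
  refine @measurable_pi_lambda _ _ _ (_) _ _ fun m => ?_
  refine @measurable_to_countable' G (ℤ → G) _ _ (_) _ fun g => ?_
  refine MeasurableSpace.measurableSet_generateFrom ⟨isClopen_coord_eq m.1 g, ?_⟩
  exact ⟨{y | y m = g}, (measurable_pi_apply m :
    Measurable fun y : {m : ℤ // m < n} → G => y m) (measurableSet_singleton g), rfl⟩

theorem compatibleAt_of_isClopen {μ : Measure (ℤ → G)} [IsFiniteMeasure μ] {n : ℤ}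
    (h : ∀ g E, IsClopen E → PastMeasurable n E →
      μ (E ∩ {x | x n = g}) = ∫⁻ x in E, ENNReal.ofReal (imitationKernel θ P n g x) ∂μ) :
    CompatibleAt θ P n μ := by
  intro g E hE
  have key : ∀ F, IsClopen F → PastMeasurable n F → μ.restrict {x | x n = g} F
      = μ.withDensity (fun x => ENNReal.ofReal (imitationKernel θ P n g x)) F := fun F hF hF' => by
    rw [Measure.restrict_apply hF'.measurableSet, withDensity_apply _ hF'.measurableSet,
      h g F hF hF']
  have h1 := ext_on_measurableSpace_of_generate_finite
    (μ := μ.restrict {x | x n = g})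
    (ν := μ.withDensity fun x => ENNReal.ofReal (imitationKernel θ P n g x))
    MeasurableSpace.pi {E | IsClopen E ∧ PastMeasurable n E} (fun F hF => key F hF.1 hF.2)
    (fun F hF => PastMeasurable.measurableSet hF)
    (past_eq_generateFrom_isClopen n)
    (fun s hs t ht _ => ⟨hs.1.inter ht.1, MeasurableSet.inter hs.2 ht.2⟩)
    (key _ isClopen_univ MeasurableSet.univ) hE
  rwa [Measure.restrict_apply hE.measurableSet, withDensity_apply _ hE.measurableSet] at h1

theorem exists_compatible [BorelSpace G] [Nonempty G] (h0 : θ 0 = 0)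
    (hcont : ∀ n g, Continuous (imitationKernel θ P n g))
    (hnn : ∀ n g x, 0 ≤ imitationKernel θ P n g x)
    (hsum : ∀ n x, ∑ g, ENNReal.ofReal (imitationKernel θ P n g x) = 1) :
    ∃ μ : Measure (ℤ → G), IsProbabilityMeasure μ ∧ Compatible θ P μ := by
  have hmeas : ∀ n g, Measurable (imitationKernel θ P n g) := fun n g => (hcont n g).measurable
  have hle : ∀ n g x, imitationKernel θ P n g x ≤ 1 := fun n g x => by
    rw [← ENNReal.ofReal_le_one, ← hsum n x]
    exact Finset.single_le_sum (f := fun g => ENNReal.ofReal (imitationKernel θ P n g x))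
      (fun _ _ => zero_le) (Finset.mem_univ g)
  have hiff : ∀ (μ : Measure (ℤ → G)) [IsProbabilityMeasure μ] n g (E F : Set (ℤ → G)),
      μ F = ∫⁻ x in E, ENNReal.ofReal (imitationKernel θ P n g x) ∂μ ↔
        μ.real F = ∫ x in E, imitationKernel θ P n g x ∂μ := by
    intro μ _ n g E F
    have hint : Integrable (imitationKernel θ P n g) (μ.restrict E) :=
      Integrable.of_bound (hmeas n g).aestronglyMeasurable 1
        (Filter.Eventually.of_forall fun x => by
          rw [Real.norm_of_nonneg (hnn n g x)]
          exact hle n g x)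
    rw [← ofReal_integral_eq_lintegral_ofReal hint (Filter.Eventually.of_forall (hnn n g)),
      ← ofReal_measureReal (μ := μ) (s := F), ENNReal.ofReal_eq_ofReal_iff measureReal_nonneg
        (integral_nonneg (hnn n g))]
  let K : ℕ → Set (ProbabilityMeasure (ℤ → G)) := fun N =>
    ⋂ (n : ℤ) (_ : |n| ≤ N) (g : G) (E : Set (ℤ → G)) (_ : IsClopen E) (_ : PastMeasurable n E),
      {μ | (μ : Measure (ℤ → G)).real (E ∩ {x | x n = g})
        = ∫ x in E, imitationKernel θ P n g x ∂(μ : Measure (ℤ → G))}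
  have hKclosed : ∀ N, IsClosed (K N) := fun N =>
    isClosed_iInter fun n => isClosed_iInter fun _ => isClosed_iInter fun g =>
      isClosed_iInter fun E => isClosed_iInter fun hE => isClosed_iInter fun _ =>
        isClosed_setOf_measure_eq_integral hE (hE.inter (isClopen_coord_eq n g)) (hcont n g)
  obtain ⟨μ, hμ⟩ := IsCompact.nonempty_iInter_of_sequence_nonempty_isCompact_isClosed K
    (fun N μ hμ => by
      simp only [K, Set.mem_iInter] at hμ ⊢
      exact fun n hn => hμ n (by push_cast; omega))
    (fun N => by
      obtain ⟨μ, hμ, h⟩ := exists_compatibleAt_window h0 hmeas hsum (-N) (2 * N + 1)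
      refine ⟨⟨μ, hμ⟩, Set.mem_iInter₂.2 fun n hn => Set.mem_iInter₂.2 fun g E =>
        Set.mem_iInter₂.2 fun _ hE => (hiff μ n g E _).1 ?_⟩
      have hn' := abs_le.1 hn
      exact h n hn'.1 (by push_cast; omega) g E hE)
    (hKclosed 0).isCompact hKclosed
  refine ⟨μ, inferInstance, fun n g E hE => (hiff μ n g E _).1 ?_⟩
  refine compatibleAt_of_isClopen (fun g E hE hE' => (hiff μ n g E _).2 ?_) g E hE
  have := Set.mem_iInter.1 hμ n.natAbs
  simp only [K, Set.mem_iInter] at this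
  exact this n (Int.abs_eq_natAbs n).le g E hE hE'

end Topological

end Existence

/-- for `gcd(A) = 1`, irreducible and aperiodic `P_(·)`, the set
`𝒢(p)` has a unique element `μ`, whose single-site marginals equal the unique
invariant probability vector `λ̂` of `P̂ = ∑_k θ_k P_(k)`. -/
theorem stmt_15 {G : Type*} [Fintype G] [DecidableEq G] [Nonempty G]
    [MeasurableSpace G] [MeasurableSingletonClass G]
    (A : Set ℕ) (hA : A.Nonempty) (hApos : ∀ k ∈ A, 0 < k)
    (θ : ℕ → ℝ) (hθpos : ∀ k ∈ A, 0 < θ k) (hθ0 : ∀ k, k ∉ A → θ k = 0)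
    (hθsum : HasSum θ 1)
    (P : ℕ → G → G → ℝ)
    (hPnn : ∀ k ∈ A, ∀ i j : G, 0 ≤ P k i j)
    (hProw : ∀ k ∈ A, ∀ i : G, ∑ j, P k i j = 1)
    (hirr : ∀ i j : G, Communicates A P i j)
    (hgcdA : IsGCDOfSet A 1)
    (haper : ∀ i : G, IsGCDOfSet (ReturnDepths A P i) 1) :
    (∃! μ : Measure (ℤ → G), IsProbabilityMeasure μ ∧ Compatible θ P μ) ∧
    (∃! lam : G → ℝ, (∀ g : G, 0 ≤ lam g) ∧ (∑ g, lam g = 1) ∧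
      (∀ g : G, ∑' k : ℕ, θ k * ∑ i, lam i * P k i g = lam g)) ∧
    (∀ (μ : Measure (ℤ → G)) (lam : G → ℝ),
      IsProbabilityMeasure μ → Compatible θ P μ →
      ((∀ g : G, 0 ≤ lam g) ∧ (∑ g, lam g = 1) ∧
        (∀ g : G, ∑' k : ℕ, θ k * ∑ i, lam i * P k i g = lam g)) →
      ∀ (n : ℤ) (g : G), (μ {x : ℤ → G | x n = g}).toReal = lam g) := by
  have h0 : θ 0 = 0 := hθ0 0 fun h => (hApos 0 h).false
  have hback : ∀ g j, ∃ d, BackReach (fun k g i => k ∈ A ∧ 0 < P k i g) d g j := fun g j => by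
    obtain ⟨l, hl, h⟩ := hirr j g
    exact ⟨_, backReach_of_wordK_pos hPnn hl.2 h⟩
  obtain ⟨n₀, hreach⟩ := BackReach.eventually hback fun g e he => (haper g).2 e <| by
    rintro _ ⟨l, hl, h, rfl⟩
    exact he _ (backReach_of_wordK_pos hPnn hl.2 h)
  have hhasSum : ∀ lam : G → ℝ, (∀ g, ∑' k : ℕ, θ k * ∑ i, lam i * P k i g = lam g) →
      ∀ g, HasSum (fun k => θ k * ∑ i, lam i * P k i g) (lam g) := fun lam h g =>
    h g ▸ (hasSum_invariant hθpos hθ0 hθsum hPnn hProw lam g).summable.hasSum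
  have hmarg : ∀ (μ : Measure (ℤ → G)) (lam : G → ℝ), IsProbabilityMeasure μ → Compatible θ P μ →
      ((∀ g : G, 0 ≤ lam g) ∧ (∑ g, lam g = 1) ∧
        (∀ g : G, ∑' k : ℕ, θ k * ∑ i, lam i * P k i g = lam g)) →
      ∀ (n : ℤ) (g : G), (μ {x : ℤ → G | x n = g}).toReal = lam g := by
    rintro μ lam hμ hc ⟨hl0, hl1, hl⟩ n g
    exact hc.measureReal_coord hApos hθpos hθ0 hθsum hPnn hProw hreach
      (invariant_pos hθpos hθ0 hPnn hback hl0 hl1 (hhasSum lam hl)) hl1 (hhasSum lam hl) n g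
  obtain ⟨lam, hl0, hl1, hl⟩ := exists_invariant_vector
    (Q := fun i g => ∑' k, θ k * P k i g)
    (fun i g => tsum_nonneg fun k => (imitation_term_mem_Icc hθpos hθ0 hPnn hProw k i g).1)
    (fun i => sum_tsum_imitation hθpos hθ0 hθsum hPnn hProw fun _ => i)
  have hinv : ∀ g, HasSum (fun k => θ k * ∑ i, lam i * P k i g) (lam g) := fun g =>
    hl g ▸ hasSum_invariant hθpos hθ0 hθsum hPnn hProw lam g
  obtain ⟨μ, hμ, hc⟩ : ∃ μ : Measure (ℤ → G), IsProbabilityMeasure μ ∧ Compatible θ P μ := by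
    let _ : TopologicalSpace G := ⊥
    have : DiscreteTopology G := ⟨rfl⟩
    have : BorelSpace G := ⟨by
      rw [borel_eq_top_of_discrete]
      exact top_unique fun s _ => s.toFinite.measurableSet⟩
    exact exists_compatible h0 (continuous_imitationKernel hθpos hθ0 hθsum hPnn hProw)
      (imitationKernel_nonneg hθpos hθ0 hPnn hProw)
      (sum_ofReal_imitationKernel hθpos hθ0 hθsum hPnn hProw)
  refine ⟨⟨μ, ⟨hμ, hc⟩, ?_⟩, ⟨lam, ⟨hl0, hl1, fun g => (hinv g).tsum_eq⟩, ?_⟩, hmarg⟩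
  · rintro ν ⟨hν, hc'⟩
    exact measure_eq_of_walkerCylinder fun N c => hc'.measureReal_walkerCylinder_eq hApos hθpos hθ0
      hθsum hPnn hProw hreach (invariant_pos hθpos hθ0 hPnn hback hl0 hl1 hinv) hl1 hinv hc c
  · intro lam' hlam'
    funext g
    rw [← hmarg μ lam' hμ hc hlam' 0 g,
      hmarg μ lam hμ hc ⟨hl0, hl1, fun g => (hinv g).tsum_eq⟩ 0 g]
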